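/- Let k ≥ 2 and m₁,…,m_k ≥ 2. Two points ((x₁,z₁),…,(x_k,z_k)) and ((y₁,w₁),…,(y_k,w_k)) of S^{m₁} × ⋯ × S^{m_k} lie in the same T^{k−1}-orbit if and only if (x₁, x₂, …, x_k, z₁z₂⋯z_k) = (y₁, y₂, …, y_k, w₁w₂⋯w_k); that is, the fibers of the map ((x₁,z₁),…,(x_k,z_k)) ↦ (x₁, …, x_k, z₁z₂⋯z_k) are exactly the orbits of the action. -/

import Mathlib

open scoped BigOperators

noncomputable section

def chainExt (k : ℕ) {G : Type*} [One G] (r : Fin (k - 1) → G) (j : ℕ) : G :=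
  if h : 1 ≤ j ∧ j ≤ k - 1 then r ⟨j - 1, by omega⟩ else 1

/-- The sphere `S^{m i} = {(x, z) ∈ ℝ^{m i - 1} × ℂ : |x|² + |z|² = 1}`. -/
abbrev TSphere (n : ℕ) : Type :=
  {p : EuclideanSpace ℝ (Fin n) × ℂ // ‖p.1‖ ^ 2 + ‖p.2‖ ^ 2 = 1}

/-- The orbit relation of the action of `T^{k-1}` on `S^{m₁} × ⋯ × S^{m_k}` by
`(r₁,…,r_{k-1})·((x₁,z₁),…,(x_k,z_k)) = ((x₁, z₁r₁⁻¹), (x₂, r₁z₂r₂⁻¹), …, (x_k, r_{k-1}z_k))`. -/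
def tRel (k : ℕ) (m : Fin k → ℕ) (a b : ∀ i : Fin k, TSphere (m i - 1)) : Prop :=
  ∃ r : Fin (k - 1) → ℂ, (∀ j, ‖r j‖ = 1) ∧
    ∀ i : Fin k, (b i).1.1 = (a i).1.1 ∧
      (b i).1.2 = chainExt k r (i : ℕ) * (a i).1.2 * (chainExt k r ((i : ℕ) + 1))⁻¹

/-- Twisting each factor by a ratio of consecutive units changes the product only by the ratio of
the first unit to the last one. -/
theorem prod_mul_chain_last {K : Type*} [Field K] {n : ℕ} {a b : Fin n → K} {c : ℕ → K}
    (hc : ∀ j, c j ≠ 0) (h : ∀ i, b i = c i * a i * (c (i + 1))⁻¹) :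
    (∏ i, b i) * c n = c 0 * ∏ i, a i := by
  induction n with
  | zero => simp
  | succ n ih =>
    have ih' := ih (a := fun i => a i.castSucc) (b := fun i => b i.castSucc)
      fun i => by simpa using h i.castSucc
    have hl := h (Fin.last n)
    rw [eq_mul_inv_iff_mul_eq₀ (hc _), Fin.val_last] at hl
    rw [Fin.prod_univ_castSucc, Fin.prod_univ_castSucc]
    linear_combination (∏ i : Fin n, b i.castSucc) * hl + a (Fin.last n) * ih'

/-- If two finite families have equal norms termwise and their products agree up to the phases
`s` and `t`, then a chain of phases from `s` to `t` carries one family to the other. -/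
theorem exists_chain_of_mul_prod_eq {K : Type*} [NormedField K] {n : ℕ} {a b : Fin n → K} {s t : K}
    (hs : ‖s‖ = 1) (ht : ‖t‖ = 1) (hab : ∀ i, ‖a i‖ = ‖b i‖)
    (h : s * ∏ i, a i = t * ∏ i, b i) :
    ∃ c : ℕ → K, (∀ j, ‖c j‖ = 1) ∧ c 0 = s ∧ c n = t ∧
      ∀ i, b i = c i * a i * (c (i + 1))⁻¹ := by
  induction n generalizing t with
  | zero => exact ⟨fun _ => s, fun _ => hs, rfl, by simpa using h, fun i => i.elim0⟩
  | succ n ih =>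
    rw [Fin.prod_univ_castSucc, Fin.prod_univ_castSucc] at h
    set A := ∏ i : Fin n, a i.castSucc with hA
    set B := ∏ i : Fin n, b i.castSucc with hB
    have hAB : ‖A‖ = ‖B‖ := by simp [hA, hB, norm_prod, hab]
    have hl := hab (Fin.last n)
    have ht0 : t ≠ 0 := norm_ne_zero_iff.mp (by simp [ht])
    obtain ⟨u, hu, hul, huA⟩ : ∃ u : K, ‖u‖ = 1 ∧ b (Fin.last n) * t = u * a (Fin.last n) ∧
        s * A = u * B := by
      by_cases ha : a (Fin.last n) = 0
      · have hb : b (Fin.last n) = 0 := by simpa [ha, eq_comm] using hl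
        by_cases hB0 : B = 0
        · exact ⟨1, by simp, by simp [ha, hb], by rw [hB0, norm_eq_zero.mp (hAB.trans (by simp [hB0]))]; simp⟩
        · refine ⟨s * A / B, ?_, by simp [ha, hb], by field_simp⟩
          rw [norm_div, norm_mul, hs, hAB, one_mul, div_self (norm_ne_zero_iff.mpr hB0)]
      · refine ⟨b (Fin.last n) * t / a (Fin.last n), ?_, by field_simp, ?_⟩
        · rw [norm_div, norm_mul, ht, hl, mul_one, div_self]
          rw [← hl]
          exact norm_ne_zero_iff.mpr ha
        · field_simp
          linear_combination h
    obtain ⟨c, hc, hc0, hcn, hcb⟩ := ih hu (fun i => hab i.castSucc) huA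
    refine ⟨fun j => if j ≤ n then c j else t, fun j => ?_, by simpa using hc0, by simp, ?_⟩
    · dsimp only
      split_ifs
      exacts [hc j, ht]
    · intro i
      induction i using Fin.lastCases with
      | last => simp [hcn, ← hul, ht0]
      | cast i =>
        have hi : (i : ℕ) + 1 ≤ n := i.isLt
        simpa [hi, i.isLt.le] using hcb i

theorem norm_snd_eq_of_fst_eq {n : ℕ} {p q : TSphere n} (h : p.1.1 = q.1.1) :
    ‖p.1.2‖ = ‖q.1.2‖ := by
  have hp := p.2
  have hq := q.2
  rw [h] at hp
  exact (sq_eq_sq₀ (norm_nonneg _) (norm_nonneg _)).mp (by linarith)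

theorem norm_chainExt {k : ℕ} {r : Fin (k - 1) → ℂ} (hr : ∀ j, ‖r j‖ = 1) (j : ℕ) :
    ‖chainExt k r j‖ = 1 := by
  unfold chainExt
  split_ifs
  exacts [hr _, norm_one]

theorem chainExt_eq {k : ℕ} {G : Type*} [One G] {c : ℕ → G} (h0 : c 0 = 1) (hk : c k = 1)
    {j : ℕ} (hj : j ≤ k) : chainExt k (fun i : Fin (k - 1) => c (i + 1)) j = c j := by
  unfold chainExt
  split_ifs with h
  · simp [Nat.sub_add_cancel h.1]
  · obtain rfl | rfl : j = 0 ∨ j = k := by omega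
    exacts [h0.symm, hk.symm]

/-- two points of `S^{m₁} × ⋯ × S^{m_k}` lie in the same `T^{k-1}`-orbit iff
they have the same `x`-components and the same product `z₁z₂⋯z_k`; i.e. the fibers of
`((x₁,z₁),…,(x_k,z_k)) ↦ (x₁, …, x_k, z₁z₂⋯z_k)` are exactly the orbits. -/
theorem stmt9 (k : ℕ) (hk : 2 ≤ k) (m : Fin k → ℕ) (hm : ∀ i, 2 ≤ m i)
    (a b : ∀ i : Fin k, TSphere (m i - 1)) :
    tRel k m a b ↔
      ((∀ i, (a i).1.1 = (b i).1.1) ∧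
        (List.ofFn fun i => (a i).1.2).prod = (List.ofFn fun i => (b i).1.2).prod) := by
  rw [List.prod_ofFn, List.prod_ofFn]
  constructor
  · rintro ⟨r, hr, h⟩
    refine ⟨fun i => (h i).1.symm, ?_⟩
    have hc (j : ℕ) : chainExt k r j ≠ 0 := norm_ne_zero_iff.mp (by simp [norm_chainExt hr])
    have h0 : chainExt k r 0 = 1 := dif_neg (by omega)
    have h1 : chainExt k r k = 1 := dif_neg (by omega)
    simpa [h0, h1] using (prod_mul_chain_last hc fun i => (h i).2).symm
  · rintro ⟨hx, hz⟩
    obtain ⟨c, hc, hc0, hck, hcb⟩ := exists_chain_of_mul_prod_eq (s := 1) (t := 1)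
      norm_one norm_one (fun i => norm_snd_eq_of_fst_eq (hx i)) (by simpa using hz)
    refine ⟨fun i => c (i + 1), fun j => hc _, fun i => ⟨(hx i).symm, ?_⟩⟩
    rw [chainExt_eq hc0 hck i.isLt.le, chainExt_eq hc0 hck i.isLt]
    exact hcb i
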